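/- arXiv:2102.10872 — 2 statements merged into one kernel-verified Lean document; each statement's English description precedes it below -/
import Mathlib

section
/- Let S be any semigroup and let ℕ denote the semigroup of positive integers under addition. Then the direct product ℕ × S is residually finite if and only if S is residually finite. -/
/-- `s` can be separated from `Y` in `S`: there is a homomorphism to a finite
semigroup mapping `s` outside the image of `Y`. -/
def Separates {S : Type*} [Semigroup S] (s : S) (Y : Set S) : Prop :=
  ∃ (P : Type) (_ : Semigroup P) (_ : Finite P) (φ : S →ₙ* P), φ s ∉ φ '' Y

/-- Complete separability. -/
def IsCS (S : Type*) [Semigroup S] : Prop :=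
  ∀ (s : S) (Y : Set S), s ∉ Y → Separates s Y

/-- Strong subsemigroup separability. -/
def IsSSS (S : Type*) [Semigroup S] : Prop :=
  ∀ (s : S) (Y : Subsemigroup S), s ∉ Y → Separates s (Y : Set S)

/-- Weak subsemigroup separability. -/
def IsWSS (S : Type*) [Semigroup S] : Prop :=
  ∀ (s : S) (X : Finset S), s ∉ Subsemigroup.closure (X : Set S) →
    Separates s (Subsemigroup.closure (X : Set S) : Set S)

/-- Monogenic subsemigroup separability. -/
def IsMSS (S : Type*) [Semigroup S] : Prop :=
  ∀ (s x : S), s ∉ Subsemigroup.closure {x} →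
    Separates s (Subsemigroup.closure {x} : Set S)

/-- Residual finiteness. -/
def ResiduallyFinite (S : Type*) [Semigroup S] : Prop :=
  ∀ s t : S, s ≠ t → ∃ (P : Type) (_ : Semigroup P) (_ : Finite P) (φ : S →ₙ* P), φ s ≠ φ t

/-- The syntactic congruence of a function `f` on a semigroup: the largest congruence contained in
the kernel of `f`. -/
def syntacticCon {S P : Type*} [Semigroup S] (f : S → P) : Con S where
  r a b := f a = f b ∧ (∀ x, f (x * a) = f (x * b)) ∧ (∀ y, f (a * y) = f (b * y)) ∧
    ∀ x y, f (x * a * y) = f (x * b * y)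
  iseqv :=
    { refl := fun _ => ⟨rfl, fun _ => rfl, fun _ => rfl, fun _ _ => rfl⟩
      symm := fun h => ⟨h.1.symm, fun x => (h.2.1 x).symm, fun y => (h.2.2.1 y).symm,
        fun x y => (h.2.2.2 x y).symm⟩
      trans := fun h k => ⟨h.1.trans k.1, fun x => (h.2.1 x).trans (k.2.1 x),
        fun y => (h.2.2.1 y).trans (k.2.2.1 y),
        fun x y => (h.2.2.2 x y).trans (k.2.2.2 x y)⟩ }
  mul' := by
    rintro a b c d ⟨-, -, hr, hlr⟩ ⟨-, kl, -, klr⟩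
    refine ⟨(hr c).trans (kl b), fun x => ?_, fun y => ?_, fun x y => ?_⟩
    · rw [← mul_assoc, hlr, kl, mul_assoc]
    · rw [mul_assoc, hr, ← mul_assoc, klr]
    · rw [← mul_assoc, mul_assoc, hlr, ← mul_assoc, klr, ← mul_assoc x b d]

theorem syntacticCon_apply {S P : Type*} [Semigroup S] {f : S → P} {a b : S} :
    syntacticCon f a b ↔ f a = f b ∧ (∀ x, f (x * a) = f (x * b)) ∧
      (∀ y, f (a * y) = f (b * y)) ∧ ∀ x y, f (x * a * y) = f (x * b * y) :=
  Iff.rfl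

/-- A congruence whose classes are determined by a function with finite codomain has finite
index. -/
theorem Con.finite_quotient_of_forall_eq {S Q : Type*} [Semigroup S] [Finite Q] (c : Con S)
    (g : S → Q) (hg : ∀ a b, g a = g b → c a b) : Finite c.Quotient := by
  refine Finite.of_injective (fun q : c.Quotient => g (Quotient.out q)) fun p q h => ?_
  exact Quotient.out_equiv_out.mp (hg _ _ h)

/-- A congruence of finite index separates inequivalent elements in a finite semigroup living in
the bottom universe. -/
theorem Con.exists_finite_mulHom_ne {S : Type*} [Semigroup S] (c : Con S) [Finite c.Quotient]
    {s t : S} (h : ¬ c s t) :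
    ∃ (P : Type) (_ : Semigroup P) (_ : Finite P) (φ : S →ₙ* P), φ s ≠ φ t := by
  obtain ⟨n, ⟨e⟩⟩ := Finite.exists_equiv_fin c.Quotient
  let i : Semigroup (Fin n) := e.symm.semigroup
  refine ⟨Fin n, i, inferInstance,
    @MulHom.mk S (Fin n) _ i.toMul (fun a => e (a : c.Quotient)) fun a b => ?_,
    fun hst => h (c.eq.mp (e.injective hst))⟩
  change e _ = e (e.symm (e _) * e.symm (e _))
  simp

theorem ResiduallyFinite.of_pnat_prod {S : Type*} [Semigroup S]
    (h : ResiduallyFinite (Multiplicative ℕ+ × S)) : ResiduallyFinite S := by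
  intro s t hst
  obtain ⟨P, _, _, φ, hφ⟩ := h (.ofAdd 3, s) (.ofAdd 3, t) fun e => hst (congrArg Prod.snd e)
  have hl (x a : S) : φ (.ofAdd 3, x * a) = φ (.ofAdd 2, x) * φ (.ofAdd 1, a) := by
    rw [← map_mul]; rfl
  have hr (a y : S) : φ (.ofAdd 3, a * y) = φ (.ofAdd 1, a) * φ (.ofAdd 2, y) := by
    rw [← map_mul]; rfl
  have hlr (x a y : S) :
      φ (.ofAdd 3, x * a * y) = φ (.ofAdd 1, x) * φ (.ofAdd 1, a) * φ (.ofAdd 1, y) := by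
    rw [← map_mul, ← map_mul]; rfl
  let c := syntacticCon fun a : S => φ (.ofAdd 3, a)
  have : Finite c.Quotient := by
    refine c.finite_quotient_of_forall_eq (fun a => (φ (.ofAdd 1, a), φ (.ofAdd 3, a))) ?_
    intro a b hab
    obtain ⟨h₁, h₃⟩ := Prod.mk.inj hab
    refine syntacticCon_apply.mpr ⟨h₃, fun x => ?_, fun y => ?_, fun x y => ?_⟩
    · simp only [hl, h₁]
    · simp only [hr, h₁]
    · simp only [hlr, h₁]
  exact c.exists_finite_mulHom_ne fun hc => hφ (syntacticCon_apply.mp hc).1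

theorem ResiduallyFinite.prod {S T : Type*} [Semigroup S] [Semigroup T]
    (hS : ResiduallyFinite S) (hT : ResiduallyFinite T) : ResiduallyFinite (S × T) := by
  rintro ⟨a, s⟩ ⟨b, t⟩ hne
  by_cases hab : a = b
  · obtain ⟨P, i, hf, φ, hφ⟩ := hT s t fun hst => hne (by rw [hab, hst])
    exact ⟨P, i, hf, φ.comp (MulHom.snd S T), hφ⟩
  · obtain ⟨P, i, hf, φ, hφ⟩ := hS a b hab
    exact ⟨P, i, hf, φ.comp (MulHom.fst S T), hφ⟩

theorem residuallyFinite_multiplicative_pnat : ResiduallyFinite (Multiplicative ℕ+) := by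
  intro m n hmn
  let k : ℕ+ := m.toAdd + n.toAdd
  have : NeZero (k : ℕ) := ⟨k.ne_zero⟩
  refine ⟨Multiplicative (ZMod k), inferInstance, inferInstanceAs (Finite (ZMod k)),
    ⟨fun a => .ofAdd ((a.toAdd : ℕ) : ZMod k), fun a b => ?_⟩, fun h => hmn ?_⟩
  · simp [← ofAdd_add]
  · have hmod : ((m.toAdd : ℕ) : ZMod k) = ((n.toAdd : ℕ) : ZMod k) := h
    rw [ZMod.natCast_eq_natCast_iff] at hmod
    have hk : (k : ℕ) = m.toAdd + n.toAdd := PNat.add_coe _ _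
    have hm := m.toAdd.pos
    have hn := n.toAdd.pos
    exact Multiplicative.toAdd.injective
      (PNat.eq (hmod.eq_of_lt_of_lt (by omega) (by omega)))

/-- `ℕ × S` is residually finite iff `S` is residually finite. -/
theorem stmt_2 (S : Type*) [Semigroup S] :
    ResiduallyFinite (Multiplicative ℕ+ × S) ↔ ResiduallyFinite S :=
  ⟨ResiduallyFinite.of_pnat_prod, residuallyFinite_multiplicative_pnat.prod⟩
end

section
/- Let S be a weakly subsemigroup separable semigroup and let N be a residually finite semigroup that is k-nilpotent for some positive integer k, i.e. N has a zero element 0 and every product of k elements of N equals 0. Then the direct product S × N is weakly subsemigroup separable. -/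
open Pointwise in
/-- `setPow V n` is the set `V^(n+1)` of all products of `n+1` elements of `V`. -/
def setPow {S : Type*} [Semigroup S] (V : Set S) : ℕ → Set S
  | 0 => V
  | n + 1 => setPow V n * V

theorem separates_union {S : Type*} [Semigroup S] {s : S} {Y Z : Set S}
    (hY : Separates s Y) (hZ : Separates s Z) : Separates s (Y ∪ Z) := by
  obtain ⟨P, _, _, φ, hφ⟩ := hY
  obtain ⟨Q, _, _, ψ, hψ⟩ := hZ
  refine ⟨P × Q, inferInstance, inferInstance, φ.prod ψ, ?_⟩
  rintro ⟨y, hy | hy, h⟩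
  · exact hφ ⟨y, hy, congrArg Prod.fst h⟩
  · exact hψ ⟨y, hy, congrArg Prod.snd h⟩

theorem Separates.mono {S : Type*} [Semigroup S] {s : S} {Y Z : Set S}
    (h : Separates s Z) (hYZ : Y ⊆ Z) : Separates s Y := by
  obtain ⟨P, i, j, φ, hφ⟩ := h
  exact ⟨P, i, j, φ, fun hs => hφ (Set.image_mono hYZ hs)⟩

theorem Separates.comap {S T : Type*} [Semigroup S] [Semigroup T] {s : S} {Y : Set T}
    (f : S →ₙ* T) (h : Separates (f s) Y) : Separates s (f ⁻¹' Y) := by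
  obtain ⟨P, i, j, φ, hφ⟩ := h
  exact ⟨P, i, j, φ.comp f, fun ⟨y, hy, h⟩ => hφ ⟨f y, hy, h⟩⟩

theorem ResiduallyFinite.separates_finite {S : Type*} [Semigroup S] (hS : ResiduallyFinite S)
    {Y : Set S} (hY : Y.Finite) {s : S} (hs : s ∉ Y) : Separates s Y := by
  induction Y, hY using Set.Finite.induction_on with
  | empty => exact ⟨PUnit, inferInstance, inferInstance, ⟨fun _ => PUnit.unit, fun _ _ => rfl⟩,
      by simp⟩
  | @insert a Y _ _ ih =>
    simp only [Set.mem_insert_iff, not_or] at hs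
    rw [Set.insert_eq]
    refine separates_union ?_ (ih hs.2)
    obtain ⟨P, i, j, φ, hφ⟩ := hS s a hs.1
    exact ⟨P, i, j, φ, by simpa using hφ⟩

theorem eq_or_eq_mul_of_mem_closure_singleton {S : Type*} [Semigroup S] {t x : S}
    (hx : x ∈ Subsemigroup.closure {t}) :
    x = t ∨ ∃ u ∈ Subsemigroup.closure {t}, x = t * u := by
  induction hx using Subsemigroup.closure_induction with
  | mem x hx => exact Or.inl hx
  | mul x y _ hy ihx _ =>
    right
    rcases ihx with rfl | ⟨u, hu, rfl⟩
    · exact ⟨y, hy, rfl⟩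
    · exact ⟨u * y, mul_mem hu hy, mul_assoc _ _ _⟩

theorem mul_comm_of_mem_closure_singleton {S : Type*} [Semigroup S] {t x y : S}
    (hx : x ∈ Subsemigroup.closure {t}) (hy : y ∈ Subsemigroup.closure {t}) :
    x * y = y * x := by
  have key : ∀ w ∈ Subsemigroup.closure {t}, Commute t w := by
    intro w hw
    induction hw using Subsemigroup.closure_induction with
    | mem w hw => rw [Set.mem_singleton_iff.1 hw]
    | mul a b _ _ ha hb => exact ha.mul_right hb
  induction hx using Subsemigroup.closure_induction with
  | mem x hx => rw [Set.mem_singleton_iff.1 hx]; exact key y hy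
  | mul a b _ _ ha hb => exact Commute.mul_left ha hb

theorem IsWSS.residuallyFinite {S : Type*} [Semigroup S] (hS : IsWSS S) :
    ResiduallyFinite S := by
  intro s t hst
  by_contra! hcon
  have sep : ∀ a b : S, (∀ (P : Type) (_ : Semigroup P) (_ : Finite P) (φ : S →ₙ* P),
      φ a = φ b) → a ∈ Subsemigroup.closure {b} := by
    intro a b hab
    by_contra h
    obtain ⟨P, i, j, φ, hφ⟩ := hS a {b} (by simpa using h)
    exact hφ ⟨b, Subsemigroup.subset_closure (by simp), (hab P i j φ).symm⟩
  have hs := sep s t hcon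
  have ht := sep t s fun P i j φ => (hcon P i j φ).symm
  have hle : Subsemigroup.closure {s} ≤ Subsemigroup.closure {t} := by simpa using hs
  have htt : t ∈ Subsemigroup.closure {t} := Subsemigroup.subset_closure rfl
  obtain ⟨u, hu, hsu⟩ := (eq_or_eq_mul_of_mem_closure_singleton hs).resolve_left hst
  obtain ⟨v, hv, htv⟩ := (eq_or_eq_mul_of_mem_closure_singleton ht).resolve_left (Ne.symm hst)
  obtain ⟨e, he, hte⟩ : ∃ e ∈ Subsemigroup.closure {t}, t * e = t :=
    ⟨u * v, mul_mem hu (hle hv), by rw [← mul_assoc, ← hsu, ← htv]⟩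
  have hxe : ∀ x ∈ Subsemigroup.closure {t}, e * x = x := by
    intro x hx
    have het : e * t = t := by rw [mul_comm_of_mem_closure_singleton he htt, hte]
    rcases eq_or_eq_mul_of_mem_closure_singleton hx with rfl | ⟨w, -, rfl⟩
    · exact het
    · rw [← mul_assoc, het]
  obtain ⟨w, hw, hew⟩ : ∃ w ∈ Subsemigroup.closure {t}, e = w * t := by
    rcases eq_or_eq_mul_of_mem_closure_singleton he with h | ⟨w, hw, h⟩
    · exact ⟨e, he, by rw [hxe t htt, h]⟩
    · exact ⟨w, hw, by rw [h, mul_comm_of_mem_closure_singleton htt hw]⟩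
  have hue : u ∈ Subsemigroup.closure {e} := by
    refine sep u e fun P i j φ => ?_
    calc φ u = φ (w * s) := by rw [hsu, ← mul_assoc, ← hew, hxe u hu]
      _ = φ e := by rw [map_mul, hcon P i j φ, ← map_mul, ← hew]
  have : u = e := by
    rcases eq_or_eq_mul_of_mem_closure_singleton hue with h | ⟨x, hx, h⟩
    · exact h
    · have : ∀ x ∈ Subsemigroup.closure {e}, x = e := by
        intro x hx
        induction hx using Subsemigroup.closure_induction with
        | mem x hx => exact hx
        | mul a b _ _ ha hb => rw [ha, hb, hxe e he]
      exact this u hue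
  exact hst (by rw [hsu, this, hte])

open Pointwise in
theorem setPow_add {S : Type*} [Semigroup S] (V : Set S) (m n : ℕ) :
    setPow V (m + n + 1) = setPow V m * setPow V n := by
  induction n with
  | zero => rfl
  | succ n ih =>
    change setPow V (m + n + 1) * V = setPow V m * (setPow V n * V)
    rw [ih, mul_assoc]

theorem finite_setPow {S : Type*} [Semigroup S] {V : Set S} (hV : V.Finite) (m : ℕ) :
    (setPow V m).Finite := by
  induction m with
  | zero => exact hV
  | succ m ih => exact ih.mul hV

theorem setPow_subset_closure {S : Type*} [Semigroup S] (V : Set S) (m : ℕ) :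
    setPow V m ⊆ Subsemigroup.closure V := by
  induction m with
  | zero => exact Subsemigroup.subset_closure
  | succ m ih =>
    rintro _ ⟨a, ha, b, hb, rfl⟩
    exact mul_mem (ih ha) (Subsemigroup.subset_closure hb)

theorem exists_mem_setPow_of_mem_closure {S : Type*} [Semigroup S] {V : Set S} {x : S}
    (hx : x ∈ Subsemigroup.closure V) : ∃ m, x ∈ setPow V m := by
  induction hx using Subsemigroup.closure_induction with
  | mem x hx => exact ⟨0, hx⟩
  | mul x y _ _ hx hy =>
    obtain ⟨m, hm⟩ := hx
    obtain ⟨n, hn⟩ := hy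
    exact ⟨m + n + 1, by rw [setPow_add]; exact Set.mul_mem_mul hm hn⟩

theorem image_setPow {S T : Type*} [Semigroup S] [Semigroup T] (f : S →ₙ* T) (V : Set S)
    (m : ℕ) : f '' setPow V m = setPow (f '' V) m := by
  induction m with
  | zero => rfl
  | succ m ih => rw [setPow, setPow, Set.image_mul, ih]

theorem setPow_mono {S : Type*} [Semigroup S] {V W : Set S} (h : V ⊆ W) (m : ℕ) :
    setPow V m ⊆ setPow W m := by
  induction m with
  | zero => exact h
  | succ m ih => exact Set.mul_subset_mul ih h

/-- The products of more than `K` elements of `V` lie in the subsemigroup generated by those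
with between `K + 1` and `2 * K + 1` factors. -/
theorem setPow_subset_closure_iUnion {S : Type*} [Semigroup S] (V : Set S) (K m : ℕ)
    (hm : K ≤ m) :
    setPow V m ⊆ Subsemigroup.closure (⋃ i ∈ Set.Icc K (2 * K), setPow V i) := by
  induction m using Nat.strong_induction_on with
  | _ m ih =>
    by_cases h : m ≤ 2 * K
    · exact (Set.subset_biUnion_of_mem (u := fun i => setPow V i)
        (show m ∈ Set.Icc K (2 * K) from ⟨hm, h⟩)).trans
        Subsemigroup.subset_closure
    · obtain ⟨n, rfl⟩ : ∃ n, m = n + K + 1 := ⟨m - K - 1, by omega⟩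
      rw [setPow_add]
      rintro _ ⟨a, ha, b, hb, rfl⟩
      exact mul_mem (ih n (by omega) (by omega) ha) (ih K (by omega) le_rfl hb)

/-- The direct product of a weakly subsemigroup separable semigroup with a residually
finite `k`-nilpotent semigroup (one with a zero element `z` in which every product of
`k` elements equals `z`) is weakly subsemigroup separable. -/
theorem stmt_12 (S N : Type*) [Semigroup S] [Semigroup N] (hS : IsWSS S)
    (hN : ResiduallyFinite N) (z : N) (hz : ∀ x : N, z * x = z ∧ x * z = z)
    (k : ℕ) (hk : 1 ≤ k) (hnil : setPow (Set.univ : Set N) (k - 1) ⊆ {z}) :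
    IsWSS (S × N) := by
  set K := k - 1
  have hzero : ∀ m, K ≤ m → setPow (Set.univ : Set N) m ⊆ {z} := by
    intro m hm
    induction m, hm using Nat.le_induction with
    | base => exact hnil
    | succ m _ ih =>
      rintro _ ⟨a, ha, b, -, rfl⟩
      rw [Set.mem_singleton_iff.1 (ih ha)]
      exact (hz b).1
  rintro ⟨s, n⟩ X hsn
  set Y : Set (S × N) := (X : Set (S × N))
  have hX : Y.Finite := X.finite_toSet
  set A : Set S := MulHom.fst S N '' Y
  set G : Set S := ⋃ i ∈ Set.Icc K (2 * K), setPow A i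
  have hG : G.Finite :=
    (Set.finite_Icc _ _).biUnion fun i _ => finite_setPow (hX.image _) i
  set F : Set (S × N) := ⋃ i ∈ Set.Iio K, setPow Y i
  have hF : F.Finite := (Set.finite_Iio _).biUnion fun i _ => finite_setPow hX i
  have hsnd : ∀ m, K ≤ m → ∀ p ∈ setPow Y m, p.2 = z := by
    intro m hm p hp
    apply hzero m hm
    apply setPow_mono (Set.subset_univ _)
    rw [← image_setPow (MulHom.snd S N)]
    exact ⟨p, hp, rfl⟩
  have hGX : ∀ w ∈ Subsemigroup.closure G, (w, z) ∈ Subsemigroup.closure Y := by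
    intro w hw
    induction hw using Subsemigroup.closure_induction with
    | mem w hw =>
      obtain ⟨i, hi, hw⟩ := Set.mem_iUnion₂.1 hw
      rw [← image_setPow] at hw
      obtain ⟨p, hp, rfl⟩ := hw
      rw [← hsnd i hi.1 p hp]
      exact setPow_subset_closure Y i hp
    | mul a b _ _ ha hb => simpa [(hz z).1] using mul_mem ha hb
  have hFX : F ⊆ Subsemigroup.closure Y :=
    Set.iUnion₂_subset fun i _ => setPow_subset_closure Y i
  have hXF : (Subsemigroup.closure Y : Set (S × N)) ⊆
      F ∪ {p | p.1 ∈ Subsemigroup.closure G ∧ p.2 = z} := by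
    intro p hp
    obtain ⟨m, hm⟩ := exists_mem_setPow_of_mem_closure hp
    by_cases h : m < K
    · exact Or.inl (Set.mem_biUnion (t := fun i => setPow Y i) h hm)
    · refine Or.inr ⟨setPow_subset_closure_iUnion A K m (by omega) ?_, hsnd m (by omega) p hm⟩
      rw [← image_setPow]
      exact ⟨p, hm, rfl⟩
  refine (separates_union ((hS.residuallyFinite.prod hN).separates_finite hF
    fun h => hsn (hFX h)) ?_).mono hXF
  by_cases hn : n = z
  · subst hn
    have hs : s ∉ Subsemigroup.closure G := fun h => hsn (hGX s h)
    have hsep := hS s hG.toFinset (by simpa using hs)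
    rw [hG.coe_toFinset] at hsep
    exact (Separates.comap (s := (s, n)) (MulHom.fst S N) hsep).mono fun p hp => hp.1
  · have hsep := hN.separates_finite (Set.finite_singleton z) (s := n) hn
    exact (Separates.comap (s := (s, n)) (MulHom.snd S N) hsep).mono fun p hp => hp.2
end
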